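/- If H (the hereditarily indecomposable Q-sequences) is bqo and Q^{<ω} bqo follows from Q bqo (GHT), then Q̃ is bqo. More precisely: if H is bqo under embeddability, then Q̃ (all countable transfinite Q-sequences under embeddability) is bqo. -/

import Mathlib

/-- `s ◁ t`: there is a finite sequence `u` with `s` an initial segment of `u`
and `t` an initial segment of `u` with its first element removed. -/
def Tri (s t : List ℕ) : Prop := ∃ u : List ℕ, s <+: u ∧ t <+: u.tail

/-- The base of a set of finite sequences: all naturals occurring in some member. -/
def base (B : Set (List ℕ)) : Set ℕ := {n | ∃ s ∈ B, n ∈ s}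

/-- `B` is a block: all members are strictly increasing, the base is infinite,
every infinite subset of the base (given by its increasing enumeration `f`)
has an initial segment in `B`, and no member is a proper initial segment of another. -/
def IsBlock (B : Set (List ℕ)) : Prop :=
  (∀ s ∈ B, s.Chain' (· < ·)) ∧
  (base B).Infinite ∧
  (∀ f : ℕ → ℕ, StrictMono f → (∀ n, f n ∈ base B) →
    ∃ k, (List.range k).map f ∈ B) ∧
  ∀ s ∈ B, ∀ t ∈ B, s <+: t → s = t

/-- `B` is a barrier: as a block, but no member's range is properly contained
in the range of another member. -/
def IsBarrier (B : Set (List ℕ)) : Prop :=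
  (∀ s ∈ B, s.Chain' (· < ·)) ∧
  (base B).Infinite ∧
  (∀ f : ℕ → ℕ, StrictMono f → (∀ n, f n ∈ base B) →
    ∃ k, (List.range k).map f ∈ B) ∧
  ∀ s ∈ B, ∀ t ∈ B, (∀ n, n ∈ s → n ∈ t) → ∀ n, n ∈ t → n ∈ s

/-- A transfinite sequence of elements of `Q`: a length (an ordinal) together
with a function giving the terms (values at or beyond `len` are irrelevant). -/
structure TSeq (Q : Type) where
  len : Ordinal
  f : Ordinal → Q

/-- Embeddability of transfinite sequences: a strictly increasing map of the
index ordinals under which terms grow. -/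
def TSeq.Emb {Q : Type} [Preorder Q] (σ τ : TSeq Q) : Prop :=
  ∃ g : Ordinal → Ordinal,
    (∀ β, β < σ.len → g β < τ.len) ∧
    (∀ β γ, β < γ → γ < σ.len → g β < g γ) ∧
    (∀ β, β < σ.len → σ.f β ≤ τ.f (g β))

/-- `τ = Σₙ σₙ`, the infinite concatenation of the `σₙ`. -/
def IsConcat {Q : Type} (τ : TSeq Q) (σs : ℕ → TSeq Q) : Prop :=
  ∃ g : ℕ → Ordinal, g 0 = 0 ∧ (∀ n, g (n + 1) = g n + (σs n).len) ∧
    τ.len = ⨆ n, g n ∧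
    ∀ n, ∀ β, β < (σs n).len → τ.f (g n + β) = (σs n).f β

/-- `ρ = Σ_{n < k} σₙ`, the concatenation of the first `k` of the `σₙ`. -/
def IsFinConcat {Q : Type} (ρ : TSeq Q) (σs : ℕ → TSeq Q) (k : ℕ) : Prop :=
  ∃ g : ℕ → Ordinal, g 0 = 0 ∧ (∀ n, n < k → g (n + 1) = g n + (σs n).len) ∧
    ρ.len = g k ∧
    ∀ n, n < k → ∀ β, β < (σs n).len → ρ.f (g n + β) = (σs n).f β

/-- `⟨σₙ⟩` is quasi-monotonic: every term embeds into a later term. -/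
def QuasiMonotonic {Q : Type} [Preorder Q] (σs : ℕ → TSeq Q) : Prop :=
  ∀ n, ∃ m, n < m ∧ TSeq.Emb (σs n) (σs m)

/-- The class `H` of hereditarily indecomposable sequences: sequences of length 1,
closed under quasi-monotonic infinite concatenations. -/
inductive InH {Q : Type} [Preorder Q] : TSeq Q → Prop
  | single (σ : TSeq Q) : σ.len = 1 → InH σ
  | concat (τ : TSeq Q) (σs : ℕ → TSeq Q) :
      (∀ n, InH (σs n)) → QuasiMonotonic σs → IsConcat τ σs → InH τ


namespace GHT

def Agree (n : ℕ) (X Y : Set ℕ) : Prop := ∀ x, x < n → (x ∈ X ↔ x ∈ Y)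

def Sub (A X : Set ℕ) : Prop := X ⊆ A ∧ X.Infinite

noncomputable def sh (X : Set ℕ) : Set ℕ := X \ {sInf X}

noncomputable def nx (X : Set ℕ) (m : ℕ) : ℕ := sInf {x | x ∈ X ∧ m ≤ x}

def LC {β : Type*} (A : Set ℕ) (f : Set ℕ → β) : Prop :=
  ∀ X, Sub A X → ∃ n, ∀ Y, Sub A Y → Agree n X Y → f Y = f X

def WDec {β : Type*} (A : Set ℕ) (f : Set ℕ → β) (d : Set ℕ → ℕ) : Prop :=
  ∀ X, Sub A X → ∀ Y, Sub A Y → Agree (d X) X Y → f Y = f X ∧ d Y = d X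

theorem Agree.symm {n : ℕ} {X Y : Set ℕ} (h : Agree n X Y) : Agree n Y X :=
  fun x hx => (h x hx).symm

theorem Agree.trans {n : ℕ} {X Y Z : Set ℕ} (h : Agree n X Y) (h' : Agree n Y Z) : Agree n X Z :=
  fun x hx => (h x hx).trans (h' x hx)

theorem Agree.mono {n m : ℕ} {X Y : Set ℕ} (h : Agree n X Y) (hm : m ≤ n) : Agree m X Y :=
  fun x hx => h x (lt_of_lt_of_le hx hm)

theorem Sub.mono {A B X : Set ℕ} (h : Sub A X) (hB : A ⊆ B) : Sub B X := ⟨h.1.trans hB, h.2⟩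

theorem nx_spec {X : Set ℕ} (hX : X.Infinite) (m : ℕ) : nx X m ∈ X ∧ m ≤ nx X m := by
  have : ({x | x ∈ X ∧ m ≤ x}).Nonempty := by
    obtain ⟨x, hx, h⟩ := hX.exists_gt m
    exact ⟨x, hx, h.le⟩
  exact Nat.sInf_mem this

theorem nx_le {X : Set ℕ} {m x : ℕ} (hx : x ∈ X) (h : m ≤ x) : nx X m ≤ x :=
  Nat.sInf_le ⟨hx, h⟩

theorem nx_agree {X Y : Set ℕ} (hX : X.Infinite) (hY : Y.Infinite) {m : ℕ}
    (h : Agree (nx X m + 1) X Y) : nx Y m = nx X m := by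
  have hx := nx_spec hX m
  have hy := nx_spec hY m
  have h1 : nx Y m ≤ nx X m := nx_le ((h _ (Nat.lt_succ_self _)).1 hx.1) hx.2
  have h2 : nx X m ≤ nx Y m := nx_le ((h _ (by omega)).2 hy.1) hy.2
  omega

theorem inf_mem {X : Set ℕ} (hX : X.Infinite) : sInf X ∈ X := Nat.sInf_mem hX.nonempty

theorem sh_sub {A X : Set ℕ} (h : Sub A X) : Sub A (sh X) :=
  ⟨fun _ hx => h.1 hx.1, h.2.sdiff (Set.finite_singleton _)⟩

theorem mem_sh {X : Set ℕ} {x : ℕ} : x ∈ sh X ↔ x ∈ X ∧ x ≠ sInf X := by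
  simp [sh]

theorem sh_subset (X : Set ℕ) : sh X ⊆ X := fun _ hx => hx.1

theorem inf_agree {X Y : Set ℕ} (hX : X.Infinite) (hY : Y.Infinite) {m : ℕ}
    (h : Agree m X Y) (hm : sInf X < m) : sInf Y = sInf X := by
  have h1 : sInf Y ≤ sInf X := Nat.sInf_le ((h _ hm).1 (inf_mem hX))
  have h2 : sInf X ≤ sInf Y := Nat.sInf_le ((h _ (by omega)).2 (inf_mem hY))
  omega

theorem sh_agree {X Y : Set ℕ} (hX : X.Infinite) (hY : Y.Infinite) {m : ℕ}
    (h : Agree m X Y) (hm : sInf X < m) : Agree m (sh X) (sh Y) := by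
  intro x hx
  rw [mem_sh, mem_sh, inf_agree hX hY h hm, h x hx]

theorem WDec.bump {β : Type*} {A : Set ℕ} {f : Set ℕ → β} {d : Set ℕ → ℕ} (h : WDec A f d) :
    WDec A f (fun X => nx X (d X) + 1) := by
  intro X hX Y hY hXY
  have hx := nx_spec hX.2 (d X)
  have := h X hX Y hY (hXY.mono (by simp only; omega))
  refine ⟨this.1, ?_⟩
  simp only [this.2]
  rw [nx_agree hX.2 hY.2 hXY]

theorem LC.dec {β : Type*} {A : Set ℕ} {f : Set ℕ → β} (h : LC A f) : ∃ d, WDec A f d := by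
  refine ⟨fun X => sInf {n | ∀ Y, Sub A Y → Agree n X Y → f Y = f X}, ?_⟩
  intro X hX Y hY hXY
  simp only at hXY ⊢
  set S := fun X => {n | ∀ Y, Sub A Y → Agree n X Y → f Y = f X} with hS
  have hm : ∀ Z, Sub A Z → sInf (S Z) ∈ S Z := fun Z hZ => Nat.sInf_mem (h Z hZ)
  have hf : f Y = f X := hm X hX Y hY hXY
  refine ⟨hf, ?_⟩
  have h1 : sInf (S Y) ≤ sInf (S X) := by
    apply Nat.sInf_le
    intro Z hZ hYZ
    rw [hf]
    exact hm X hX Z hZ (hXY.trans hYZ)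
  have h2 : sInf (S X) ≤ sInf (S Y) := by
    apply Nat.sInf_le
    intro Z hZ hXZ
    rw [← hf]
    exact hm Y hY Z hZ ((hXY.mono h1).symm.trans hXZ)
  exact le_antisymm h1 h2

theorem WDec.lc {β : Type*} {A : Set ℕ} {f : Set ℕ → β} {d : Set ℕ → ℕ} (h : WDec A f d) :
    LC A f := fun X hX => ⟨d X, fun Y hY hXY => (h X hX Y hY hXY).1⟩

theorem LC.mono {β : Type*} {A B : Set ℕ} {f : Set ℕ → β} (h : LC A f) (hB : B ⊆ A) : LC B f :=
  fun X hX => (h X (hX.mono hB)).imp fun _ hn Y hY => hn Y (hY.mono hB)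

/-- homogeneous extension property -/
def Hom (A : Set ℕ) (c : Set ℕ → Prop) (s : Set ℕ) : Prop :=
  ∀ A', Sub A A' → ∃ B, Sub A' B ∧ ∃ v : Prop, ∀ Y, Sub B Y →
    (∀ y ∈ Y, ∀ x ∈ s, x < y) → (c (s ∪ Y) ↔ v)

theorem hom_step {A : Set ℕ} {c : Set ℕ → Prop} {s : Set ℕ} (hs : s.Finite)
    (h : ∀ n ∈ A, (∀ x ∈ s, x < n) → Hom A c (insert n s)) : Hom A c s := by
  classical
  intro A' hA'
  obtain ⟨M, hM⟩ := hs.bddAbove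
  -- one step
  have step : ∀ C : {C : Set ℕ // Sub A C ∧ ∀ y ∈ C, M < y}, ∃ D : {C : Set ℕ // Sub A C ∧ ∀ y ∈ C, M < y},
      ∃ a ∈ C.1, D.1 ⊆ C.1 ∧ (∀ y ∈ D.1, a < y) ∧ ∃ v : Prop, ∀ Y, Sub D.1 Y →
        (c (insert a s ∪ Y) ↔ v) := by
    rintro ⟨C, hC, hCM⟩
    have ha := inf_mem hC.2
    obtain ⟨B, hB, v, hv⟩ := h (sInf C) (hC.1 ha) (fun x hx => lt_of_le_of_lt (hM hx) (hCM _ ha))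
      (sh C) (sh_sub hC)
    have hlt : ∀ y ∈ B, sInf C < y := by
      intro y hy
      have := mem_sh.1 (hB.1 hy)
      have h1 : sInf C ≤ y := Nat.sInf_le this.1
      omega
    refine ⟨⟨B, ⟨hB.1.trans ((sh_subset C).trans hC.1), hB.2⟩, fun y hy => hCM y (hB.1 hy).1⟩,
      sInf C, ha, hB.1.trans (sh_subset C), hlt, v, ?_⟩
    intro Y hY
    apply hv Y hY
    intro y hy x hx
    rcases hx with rfl | hx
    · exact hlt y (hY.1 hy)
    · exact lt_of_le_of_lt (hM hx) (hCM _ (hB.1 (hY.1 hy)).1)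
  choose D a haC hDC haD v hv using step
  have hA0 : Sub A {x | x ∈ A' ∧ M < x} := by
    refine ⟨fun x hx => hA'.1 hx.1, ?_⟩
    have := hA'.2.sdiff (Set.finite_Iic M)
    refine this.mono ?_
    intro x hx
    exact ⟨hx.1, by simpa using hx.2⟩
  let C : ℕ → {C : Set ℕ // Sub A C ∧ ∀ y ∈ C, M < y} :=
    fun n => Nat.rec ⟨_, hA0, fun y hy => hy.2⟩ (fun _ E => D E) n
  have hC : ∀ n, C (n+1) = D (C n) := fun n => rfl
  have hmono : ∀ n m, n ≤ m → (C m).1 ⊆ (C n).1 := by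
    intro n m hnm
    induction hnm with
    | refl => exact subset_rfl
    | step _ ih => exact (hDC _).trans ih
  let b : ℕ → ℕ := fun n => a (C n)
  have hb : ∀ n m, n < m → b m ∈ (C (n+1)).1 := fun n m hnm => hmono (n+1) m hnm (haC _)
  have hbs : StrictMono b := by
    intro n m hnm
    exact haD (C n) _ (hb n m hnm)
  have hex : ∃ w : Prop, {n | v (C n) ↔ w}.Infinite := by
    by_contra hcon
    push Not at hcon
    have h1 := hcon True
    have h2 := hcon False
    have := (h1.union h2)
    apply Set.infinite_univ (α := ℕ)
    refine this.subset ?_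
    intro n _
    by_cases hh : v (C n)
    · left; simpa using hh
    · right; simpa using hh
  obtain ⟨w, hw⟩ := hex
  refine ⟨b '' {n | v (C n) ↔ w}, ⟨?_, hw.image hbs.injective.injOn⟩, w, ?_⟩
  · rintro _ ⟨n, _, rfl⟩
    exact (hmono 0 n (Nat.zero_le _) (haC _)).1
  · intro Y hY _
    obtain ⟨n, hn, hnY⟩ := hY.1 (inf_mem hY.2)
    have key := hv (C n) (sh Y) ⟨?_, (sh_sub hY).2⟩
    · have e : s ∪ Y = insert (a (C n)) s ∪ sh Y := by
        ext x
        have : a (C n) = sInf Y := hnY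
        rw [this]
        simp only [Set.mem_union, Set.mem_insert_iff, mem_sh]
        have := inf_mem hY.2
        constructor
        · rintro (h | h)
          · tauto
          · tauto
        · rintro ((h | h) | h)
          · subst h; tauto
          · tauto
          · tauto
      rw [e, key]
      exact hn
    · intro y hy
      obtain ⟨hy1, hy2⟩ := mem_sh.1 hy
      obtain ⟨m, hm, rfl⟩ := hY.1 hy1
      have h1 : sInf Y ≤ b m := Nat.sInf_le hy1
      have : b n < b m := by omega
      exact hb n m (hbs.lt_iff_lt.1 this)

theorem ramsey {A : Set ℕ} (hA : A.Infinite) {c : Set ℕ → Prop} (hc : LC A c) :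
    ∃ B, Sub A B ∧ ((∀ X, Sub B X → c X) ∨ ∀ X, Sub B X → ¬ c X) := by
  classical
  have main : Hom A c ∅ := by
    by_contra hcon
    have step : ∀ s : {s : Set ℕ // s.Finite ∧ s ⊆ A ∧ ¬ Hom A c s},
        ∃ t : {s : Set ℕ // s.Finite ∧ s ⊆ A ∧ ¬ Hom A c s}, ∃ n, t.1 = insert n s.1 ∧ ∀ x ∈ s.1, x < n := by
      rintro ⟨s, hs, hsA, hns⟩
      by_contra hno
      apply hns
      apply hom_step hs
      intro n hn hlt
      by_contra hh
      exact hno ⟨⟨insert n s, hs.insert n, Set.insert_subset hn hsA, hh⟩, n, rfl, hlt⟩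
    choose T n hT hn using step
    let S : ℕ → {s : Set ℕ // s.Finite ∧ s ⊆ A ∧ ¬ Hom A c s} :=
      fun k => Nat.rec ⟨∅, Set.finite_empty, Set.empty_subset _, hcon⟩ (fun _ E => T E) k
    have hS : ∀ k, (S (k+1)).1 = insert (n (S k)) (S k).1 := fun k => hT (S k)
    have hmono : ∀ k m, k ≤ m → (S k).1 ⊆ (S m).1 := by
      intro k m hkm
      induction hkm with
      | refl => exact subset_rfl
      | step _ ih => exact ih.trans ((Set.subset_insert _ _).trans (hS _).symm.subset)
    have hmem : ∀ k, n (S k) ∈ (S (k+1)).1 := fun k => by rw [hS]; exact Set.mem_insert _ _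
    have hnm : StrictMono (fun k => n (S k)) := by
      apply strictMono_nat_of_lt_succ
      intro k
      exact hn (S (k+1)) _ (hmem k)
    have hSX : ∀ k, ∀ x ∈ (S k).1, ∃ j < k, x = n (S j) := by
      intro k
      induction k with
      | zero => intro x hx; exact absurd hx (Set.notMem_empty x)
      | succ k ih =>
        intro x hx
        rw [hS] at hx
        rcases hx with rfl | hx
        · exact ⟨k, Nat.lt_succ_self _, rfl⟩
        · obtain ⟨j, hj, e⟩ := ih x hx
          exact ⟨j, by omega, e⟩
    let X := Set.range (fun k => n (S k))
    have hX : Sub A X := by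
      refine ⟨?_, Set.infinite_range_of_injective hnm.injective⟩
      rintro _ ⟨k, rfl⟩
      exact (S (k+1)).2.2.1 (hmem k)
    obtain ⟨N, hN⟩ := hc X hX
    apply (S N).2.2.2
    intro A' hA'
    refine ⟨A' \ Set.Iio N, ⟨Set.sdiff_subset, hA'.2.sdiff (Set.finite_Iio N)⟩, c X, ?_⟩
    intro Y hY hlt
    apply Iff.of_eq
    apply hN
    · exact ⟨Set.union_subset (S N).2.2.1 (fun y hy => hA'.1 (hY.1 hy).1), hY.2.mono Set.subset_union_right⟩
    · intro x hx
      constructor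
      · rintro ⟨k, rfl⟩
        left
        have : k ≤ n (S k) := hnm.le_apply
        exact hmono (k+1) N (by simp only at hx; omega) (hmem k)
      · rintro (h | h)
        · obtain ⟨j, _, e⟩ := hSX N x h
          exact ⟨j, e.symm⟩
        · have := (hY.1 h).2
          simp only [Set.mem_Iio] at this
          omega
  obtain ⟨B, hB, v, hv⟩ := main A ⟨subset_rfl, hA⟩
  refine ⟨B, hB, ?_⟩
  have hv' : ∀ Y, Sub B Y → (c Y ↔ v) := by
    intro Y hY
    have := hv Y hY (fun _ _ x hx => absurd hx (Set.notMem_empty x))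
    rwa [Set.empty_union] at this
  by_cases h : v
  · left; intro X hX; exact (hv' X hX).2 h
  · right; intro X hX hcX; exact h ((hv' X hX).1 hcX)

end GHT

namespace GHT

structure St {α : Type*} (r : α → α → Prop) where
  A : Set ℕ
  f : Set ℕ → List α
  d : Set ℕ → ℕ
  inf : A.Infinite
  dec : WDec A f d
  nrm : ∀ X, Sub A X → ∃ x ∈ X, d X = x + 1
  bad : ∀ X, Sub A X → ¬ List.SublistForall₂ r (f X) (f (sh X))

def St.Lt {α : Type*} {r : α → α → Prop} (T S : St r) (X : Set ℕ) : Prop :=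
  S.d X < T.d X ∧ T.f X <:+ S.f X ∧ (T.f X).length < (S.f X).length

def St.Le {α : Type*} {r : α → α → Prop} (T S : St r) : Prop :=
  T.A ⊆ S.A ∧ ∀ X, Sub T.A X → (T.d X = S.d X ∧ T.f X = S.f X) ∨ T.Lt S X

variable {α : Type*} {r : α → α → Prop}

theorem St.Le.rfl (S : St r) : S.Le S := ⟨subset_rfl, fun _ _ => Or.inl ⟨_root_.rfl, _root_.rfl⟩⟩

theorem St.Le.trans {U T S : St r} (h : U.Le T) (h' : T.Le S) : U.Le S := by
  refine ⟨h.1.trans h'.1, fun X hX => ?_⟩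
  rcases h.2 X hX with ⟨h1, h2⟩ | ⟨h1, h2, h3⟩
  · rcases h'.2 X (hX.mono h.1) with ⟨k1, k2⟩ | ⟨k1, k2, k3⟩
    · exact Or.inl ⟨h1.trans k1, h2.trans k2⟩
    · right
      refine ⟨by omega, by rwa [h2], by rwa [h2]⟩
  · rcases h'.2 X (hX.mono h.1) with ⟨k1, k2⟩ | ⟨k1, k2, k3⟩
    · right
      refine ⟨by omega, by rwa [← k2], by rwa [← k2]⟩
    · exact Or.inr ⟨by omega, h2.trans k2, by omega⟩

theorem St.Le.len {T S : St r} (h : T.Le S) {X : Set ℕ} (hX : Sub T.A X) :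
    (T.f X).length ≤ (S.f X).length ∧ S.d X ≤ T.d X ∧ T.f X <:+ S.f X := by
  rcases h.2 X hX with ⟨h1, h2⟩ | ⟨h1, h2, h3⟩
  · rw [h1, h2]; exact ⟨le_rfl, le_rfl, List.suffix_refl _⟩
  · exact ⟨h3.le, h1.le, h2⟩

theorem sf_suffix {l l' l'' : List α} (h : List.SublistForall₂ r l l') (h' : l' <:+ l'') :
    List.SublistForall₂ r l l'' := by
  obtain ⟨t, rfl⟩ := h'
  induction t with
  | nil => exact h
  | cons a t ih => exact List.SublistForall₂.cons_right ih

def Stem (n : ℕ) (T : St r) (s : Finset ℕ) (X : Set ℕ) : Prop :=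
  Sub T.A X ∧ (∀ x < n, x ∈ X ↔ x ∈ s) ∧ T.d X ≤ n

open Classical in
noncomputable def wt (n : ℕ) (T : St r) (s : Finset ℕ) : ℕ :=
  if h : ∃ X, Stem n T s X then (T.f h.choose).length + 1 else 0

theorem wt_eq {n : ℕ} {T : St r} {s : Finset ℕ} {X : Set ℕ} (h : Stem n T s X) :
    wt n T s = (T.f X).length + 1 := by
  have hex : ∃ X, Stem n T s X := ⟨X, h⟩
  unfold wt
  rw [dif_pos hex]
  have hc := hex.choose_spec
  have := (T.dec X h.1 _ hc.1 (fun x hx => by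
    have := lt_of_lt_of_le hx h.2.2
    rw [h.2.1 x this, hc.2.1 x this])).1
  rw [this]

theorem wt_mono {n : ℕ} {U T : St r} (h : U.Le T) (s : Finset ℕ) : wt n U s ≤ wt n T s := by
  by_cases hex : ∃ X, Stem n U s X
  · obtain ⟨X, hX⟩ := hex
    have hl := h.len hX.1
    have : Stem n T s X := ⟨hX.1.mono h.1, hX.2.1, hl.2.1.trans hX.2.2⟩
    rw [wt_eq hX, wt_eq this]
    omega
  · unfold wt
    rw [dif_neg hex]
    exact Nat.zero_le _

theorem minz (n : ℕ) (S : St r) : ∃ T : St r, T.Le S ∧ Agree n T.A S.A ∧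
    ∀ U : St r, U.Le T → Agree n U.A T.A → ∀ X, Sub U.A X → T.d X ≤ n → U.f X = T.f X := by
  classical
  let μ : St r → ℕ := fun T => ∑ s ∈ (Finset.range n).powerset, wt n T s
  obtain ⟨T, ⟨hT1, hT2⟩, hmin⟩ := (measure μ).wf.has_min
    {T : St r | T.Le S ∧ Agree n T.A S.A} ⟨S, St.Le.rfl S, fun _ _ => Iff.rfl⟩
  refine ⟨T, hT1, hT2, ?_⟩
  intro U hU hUA X hX hd
  by_contra hne
  refine hmin U ⟨hU.trans hT1, hUA.trans hT2⟩ ?_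
  change μ U < μ T
  apply Finset.sum_lt_sum
  · intro s _; exact wt_mono hU s
  · let s := (Finset.range n).filter (· ∈ X)
    refine ⟨s, by simp [s], ?_⟩
    have hsX : ∀ x < n, x ∈ X ↔ x ∈ s := by
      intro x hx; simp [s, hx]
    have hXT : Stem n T s X := ⟨hX.mono hU.1, hsX, hd⟩
    rw [wt_eq hXT]
    by_cases hex : ∃ X, Stem n U s X
    · obtain ⟨Y, hY⟩ := hex
      rw [wt_eq hY]
      have hag : ∀ m, m ≤ n → Agree m Y X := fun m hm x hx => by
        rw [hsX x (by omega), hY.2.1 x (by omega)]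
      have hf : U.f X = U.f Y := (U.dec Y hY.1 X hX (hag _ hY.2.2)).1
      rcases hU.2 X hX with ⟨_, h2⟩ | ⟨_, _, h3⟩
      · exact absurd h2 hne
      · rw [← hf]; omega
    · have : wt n U s = 0 := by unfold wt; rw [dif_neg hex]
      omega

theorem minbad (S₀ : St r) : ∃ T : St r, ∀ U : St r, U.A ⊆ T.A → ¬ ∀ X, Sub U.A X → U.Lt T X := by
  classical
  choose Z hZ1 hZ2 hZ3 using @minz α r
  let S : ℕ → St r := fun n => Nat.rec S₀ (fun n T => if n ∈ T.A then Z (n+1) T else T) n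
  have hS : ∀ n, S (n+1) = if n ∈ (S n).A then Z (n+1) (S n) else S n := fun n => rfl
  have hstep : ∀ n, (S (n+1)).Le (S n) := by
    intro n; rw [hS]; split_ifs
    · exact hZ1 _ _
    · exact St.Le.rfl _
  have hag : ∀ n, Agree (n+1) (S (n+1)).A (S n).A := by
    intro n; rw [hS]; split_ifs
    · exact hZ2 _ _
    · exact fun _ _ => Iff.rfl
  have hle : ∀ n m, n ≤ m → (S m).Le (S n) := by
    intro n m h
    induction h with
    | refl => exact St.Le.rfl _
    | step _ ih => exact (hstep _).trans ih
  have hagm : ∀ n m, n ≤ m → Agree n (S m).A (S n).A := by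
    intro n m h
    induction h with
    | refl => exact fun _ _ => Iff.rfl
    | @step m h ih => exact ((hag m).mono (by simp only [Nat.le_eq] at h; omega)).trans ih
  let A : Set ℕ := {x | ∀ n, x ∈ (S n).A}
  have hAsub : ∀ n, A ⊆ (S n).A := fun n x hx => hx n
  have hAag : ∀ n, Agree n A (S n).A := by
    intro n x hx
    refine ⟨fun h => h n, fun h m => ?_⟩
    rcases le_total n m with h' | h'
    · exact (hagm n m h' x hx).2 h
    · exact (hle m n h').1 h
  have hAinf : A.Infinite := by
    intro hfin
    obtain ⟨N', hN'⟩ := hfin.bddAbove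
    let N := N' + 1
    obtain ⟨hx1, hx2⟩ := nx_spec (S N).inf N
    set x := nx (S N).A N with hxdef
    have hconst : ∀ m, N ≤ m → m ≤ x → S m = S N := by
      intro m hm
      induction hm with
      | refl => intro _; rfl
      | @step m hm ih =>
        intro hmx
        have ih := ih (by simp only [Nat.succ_eq_add_one] at hmx; omega)
        have : m ∉ (S m).A := by
          rw [ih]
          intro hmem
          have := nx_le hmem hm
          simp only [Nat.succ_eq_add_one] at hmx
          omega
        change S (m+1) = _
        rw [hS, if_neg this, ih]
    have h1 : x ∈ (S x).A := by rw [hconst x hx2 le_rfl]; exact hx1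
    have h2 : x ∈ (S (x+1)).A := (hag x x (Nat.lt_succ_self _)).2 h1
    have h3 : x ∈ A := (hAag (x+1) x (Nat.lt_succ_self _)).2 h2
    have := hN' h3
    omega
  have hstab : ∀ X, ∃ N, Sub A X → ∀ m, N ≤ m →
      (S m).d X = (S N).d X ∧ (S m).f X = (S N).f X := by
    intro X
    obtain ⟨N, -, hN⟩ := (measure (fun n => ((S n).f X).length)).wf.has_min Set.univ ⟨0, trivial⟩
    refine ⟨N, fun hX m hm => ?_⟩
    rcases (hle N m hm).2 X (hX.mono (hAsub m)) with h | ⟨_, _, h⟩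
    · exact h
    · exact absurd h (hN m trivial)
  choose N hN using hstab
  let f : Set ℕ → List α := fun X => (S (N X)).f X
  let d : Set ℕ → ℕ := fun X => (S (N X)).d X
  have hf : ∀ X, Sub A X → ∀ m, N X ≤ m → (S m).d X = d X ∧ (S m).f X = f X := hN
  let T : St r := {
    A := A
    f := f
    d := d
    inf := hAinf
    dec := by
      intro X hX Y hY hXY
      let m := max (N X) (N Y)
      obtain ⟨h1, h2⟩ := hf X hX m (le_max_left _ _)
      obtain ⟨h3, h4⟩ := hf Y hY m (le_max_right _ _)
      rw [← h1, ← h2, ← h3, ← h4]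
      rw [← h1] at hXY
      exact (S m).dec X (hX.mono (hAsub m)) Y (hY.mono (hAsub m)) hXY
    nrm := fun X hX => (S (N X)).nrm X (hX.mono (hAsub _))
    bad := by
      intro X hX
      let m := max (N X) (N (sh X))
      obtain ⟨h1, h2⟩ := hf X hX m (le_max_left _ _)
      obtain ⟨h3, h4⟩ := hf (sh X) (sh_sub hX) m (le_max_right _ _)
      rw [← h2, ← h4]
      exact (S m).bad X (hX.mono (hAsub m)) }
  have hTle : ∀ n, T.Le (S n) := by
    intro n
    refine ⟨hAsub n, fun X hX => ?_⟩
    let m := max (N X) n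
    obtain ⟨h1, h2⟩ := hf X hX m (le_max_left _ _)
    have := (hle n m (le_max_right _ _)).2 X (hX.mono (hAsub m))
    unfold St.Lt at this ⊢
    rw [h1, h2] at this
    exact this
  refine ⟨T, ?_⟩
  intro U hUA hU
  -- minimal stem
  obtain ⟨X₀, hX₀, hmin⟩ := (measure T.d).wf.has_min {X | Sub U.A X} ⟨U.A, subset_rfl, U.inf⟩
  have hmin : ∀ X, Sub U.A X → T.d X₀ ≤ T.d X := fun X hX => not_lt.1 (hmin X hX)
  set n := T.d X₀ with hn
  obtain ⟨x₀, hx₀, hnx⟩ := T.nrm X₀ (hX₀.mono hUA)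
  let C : Set ℕ := {x | x ∈ T.A ∧ (x < n ∨ x ∈ U.A)}
  have hCT : C ⊆ T.A := fun x hx => hx.1
  have hUC : U.A ⊆ C := fun x hx => ⟨hUA hx, Or.inr hx⟩
  have hCU : ∀ x ∈ C, n ≤ x → x ∈ U.A := by
    rintro x ⟨_, h | h⟩ h'
    · omega
    · exact h
  have hsmall : ∀ X, Sub C X → T.d X < n → ¬ X ⊆ U.A := by
    intro X hX hd hsub
    have := hmin X ⟨hsub, hX.2⟩
    omega
  -- agreement determines inclusion
  have hincl : ∀ X Y, Sub C X → Sub C Y → Agree (T.d X) X Y → X ⊆ U.A → Y ⊆ U.A := by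
    intro X Y hX hY hXY hsub y hy
    by_cases hyn : n ≤ y
    · exact hCU y (hY.1 hy) hyn
    · have h1 : n ≤ T.d X := not_lt.1 fun h => hsmall X hX h hsub
      exact hsub ((hXY y (by omega)).2 hy)
  let V : St r := {
    A := C
    f := fun X => if X ⊆ U.A then U.f X else T.f X
    d := fun X => if X ⊆ U.A then U.d X else T.d X
    inf := U.inf.mono hUC
    dec := by
      intro X hX Y hY hXY
      by_cases hXU : X ⊆ U.A
      · simp only [if_pos hXU] at hXY ⊢
        have hlt := (hU X ⟨hXU, hX.2⟩).1
        have hYU := hincl X Y hX hY (hXY.mono hlt.le) hXU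
        simp only [if_pos hYU]
        exact U.dec X ⟨hXU, hX.2⟩ Y ⟨hYU, hY.2⟩ hXY
      · simp only [if_neg hXU] at hXY ⊢
        have h1 := T.dec X (hX.mono hCT) Y (hY.mono hCT) hXY
        have hYU : ¬ Y ⊆ U.A := fun h => hXU (hincl Y X hY hX (by rw [h1.2]; exact hXY.symm) h)
        simp only [if_neg hYU]
        exact h1
    nrm := by
      intro X hX
      by_cases hXU : X ⊆ U.A
      · simp only [if_pos hXU]; exact U.nrm X ⟨hXU, hX.2⟩
      · simp only [if_neg hXU]; exact T.nrm X (hX.mono hCT)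
    bad := by
      intro X hX
      by_cases hXU : X ⊆ U.A
      · have : sh X ⊆ U.A := (sh_subset X).trans hXU
        simp only [if_pos hXU, if_pos this]
        exact U.bad X ⟨hXU, hX.2⟩
      · simp only [if_neg hXU]
        by_cases hs : sh X ⊆ U.A
        · simp only [if_pos hs]
          intro hsf
          exact T.bad X (hX.mono hCT) (sf_suffix hsf (hU _ ⟨hs, (sh_sub hX).2⟩).2.1)
        · simp only [if_neg hs]
          exact T.bad X (hX.mono hCT) }
  have hVT : V.Le T := by
    refine ⟨hCT, fun X hX => ?_⟩
    by_cases hXU : X ⊆ U.A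
    · right
      have := hU X ⟨hXU, hX.2⟩
      simp only [V, St.Lt, if_pos hXU]
      exact this
    · left
      simp only [V, if_neg hXU, and_self]
  have hx₀T : x₀ ∈ (S x₀).A := hAsub x₀ (hUA (hX₀.1 hx₀))
  have hSn : S (x₀+1) = Z (x₀+1) (S x₀) := by rw [hS, if_pos hx₀T]
  have hnn : n = x₀ + 1 := hnx
  have hVag : Agree (x₀+1) V.A (S (x₀+1)).A := by
    refine Agree.trans ?_ (hAag (x₀+1))
    intro x hx
    exact ⟨fun h => h.1, fun h => ⟨h, Or.inl (by omega)⟩⟩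
  have hVle := hVT.trans (hTle (x₀+1))
  have hX₀C : Sub V.A X₀ := hX₀.mono hUC
  have hdn : (S (x₀+1)).d X₀ ≤ x₀+1 := by
    have := ((hTle (x₀+1)).len (hX₀.mono hUA)).2.1
    omega
  have heq : V.f X₀ = (S (x₀+1)).f X₀ := by
    rw [hSn] at hVle hVag hdn ⊢
    exact hZ3 (x₀+1) (S x₀) V hVle hVag X₀ hX₀C hdn
  have h1 : V.f X₀ = U.f X₀ := by simp only [V, if_pos hX₀.1]
  have h2 := (hU X₀ hX₀).2.2
  have h3 := ((hTle (x₀+1)).len (hX₀.mono hUA)).1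
  rw [← h1, heq] at h2
  omega

/-- `r` is bqo, in terms of locally constant arrays. -/
def Bqo {α : Type*} (r : α → α → Prop) : Prop :=
  ∀ (A : Set ℕ) (f : Set ℕ → α), A.Infinite → LC A f → ∃ X, Sub A X ∧ r (f X) (f (sh X))

theorem no_state (h : Bqo r) (S₀ : St r) : False := by
  obtain ⟨T, hT⟩ := minbad S₀
  have hne : ∀ X, Sub T.A X → T.f X ≠ [] := by
    intro X hX he
    apply T.bad X hX
    rw [he]
    exact List.SublistForall₂.nil
  have ⟨a₀, ha₀⟩ := List.exists_mem_of_ne_nil _ (hne T.A ⟨subset_rfl, T.inf⟩)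
  let hd : Set ℕ → α := fun X => (T.f X).headD a₀
  have hfd : ∀ X, Sub T.A X → T.f X = hd X :: (T.f X).tail := by
    intro X hX
    have := hne X hX
    cases hx : T.f X with
    | nil => exact absurd hx this
    | cons a l => simp [hd, hx]
  have hc : LC T.A (fun X => r (hd X) (hd (sh X))) := by
    intro X hX
    refine ⟨max (sInf X + 1) (max (T.d X) (T.d (sh X))), fun Y hY hXY => ?_⟩
    have h1 := (T.dec X hX Y hY (hXY.mono (by simp))).1
    have h2 := (T.dec (sh X) (sh_sub hX) (sh Y) (sh_sub hY)
      ((sh_agree hX.2 hY.2 hXY (by simp)).mono (by simp))).1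
    simp only [hd, h1, h2]
  obtain ⟨B, hB, hh | hh⟩ := ramsey T.inf hc
  · let U : St r := {
      A := B
      f := fun X => (T.f X).tail
      d := fun X => nx X (T.d X) + 1
      inf := hB.2
      dec := by
        intro X hX Y hY hXY
        have := T.dec.bump X (hX.mono hB.1) Y (hY.mono hB.1) hXY
        exact ⟨by simp only [this.1], this.2⟩
      nrm := fun X hX => ⟨_, (nx_spec hX.2 _).1, rfl⟩
      bad := by
        intro X hX hsf
        apply T.bad X (hX.mono hB.1)
        rw [hfd X (hX.mono hB.1), hfd (sh X) (sh_sub (hX.mono hB.1))]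
        exact List.SublistForall₂.cons (hh X hX) hsf }
    apply hT U hB.1
    intro X hX
    refine ⟨?_, List.tail_suffix _, ?_⟩
    · have := (nx_spec hX.2 (T.d X)).2
      simp only [U]; omega
    · have := hfd X (hX.mono hB.1)
      simp only [U]
      conv_rhs => rw [this]
      simp
  · obtain ⟨X, hX, hr⟩ := h B hd hB.2 (by
      intro X hX
      refine ⟨T.d X, fun Y hY hXY => ?_⟩
      have := (T.dec X (hX.mono hB.1) Y (hY.mono hB.1) hXY).1
      simp only [hd, this])
    exact hh X hX hr

theorem ght (h : Bqo r) : Bqo (List.SublistForall₂ r) := by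
  intro A f hA hf
  by_contra hcon
  push Not at hcon
  obtain ⟨d, hd⟩ := hf.dec
  exact no_state h {
    A := A
    f := f
    d := fun X => nx X (d X) + 1
    inf := hA
    dec := hd.bump
    nrm := fun X hX => ⟨_, (nx_spec hX.2 _).1, rfl⟩
    bad := hcon }

end GHT

namespace GHT

open Classical in
theorem count_agree {n : ℕ} {X Y : Set ℕ} (h : Agree n X Y) :
    ∀ m, m ≤ n → Nat.count (· ∈ X) m = Nat.count (· ∈ Y) m := by
  intro m
  induction m with
  | zero => intro _; simp
  | succ m ih =>
    intro hm
    rw [Nat.count_succ, Nat.count_succ, ih (by omega)]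
    simp only [h m (by omega)]

theorem nth_agree {n : ℕ} {X Y : Set ℕ} (hX : X.Infinite) (h : Agree n X Y) {i : ℕ}
    (hi : Nat.nth (· ∈ X) i < n) : Nat.nth (· ∈ Y) i = Nat.nth (· ∈ X) i := by
  classical
  have h1 : Nat.nth (· ∈ X) i ∈ X := Nat.nth_mem_of_infinite (p := (· ∈ X)) hX i
  have h2 : Nat.nth (· ∈ X) i ∈ Y := (h _ hi).1 h1
  have h3 : Nat.count (· ∈ Y) (Nat.nth (· ∈ X) i) = i := by
    rw [← count_agree h _ hi.le, Nat.count_nth_of_infinite (p := (· ∈ X)) hX]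
  have := Nat.nth_count (p := (· ∈ Y)) h2
  rwa [h3] at this

theorem nth_sh {X : Set ℕ} (hX : X.Infinite) (i : ℕ) :
    Nat.nth (· ∈ sh X) i = Nat.nth (· ∈ X) (i + 1) := by
  have hs : (sh X).Infinite := (sh_sub (A := X) ⟨subset_rfl, hX⟩).2
  have m1 : StrictMono (Nat.nth (· ∈ sh X)) := Nat.nth_strictMono (p := (· ∈ sh X)) hs
  have m0 : StrictMono (Nat.nth (· ∈ X)) := Nat.nth_strictMono (p := (· ∈ X)) hX
  have m2 : StrictMono (fun i => Nat.nth (· ∈ X) (i + 1)) := by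
    intro a b hab
    exact m0 (by omega)
  have r1 : Set.range (Nat.nth (· ∈ sh X)) = sh X := Nat.range_nth_of_infinite (p := (· ∈ sh X)) hs
  have r0 : Set.range (Nat.nth (· ∈ X)) = X := Nat.range_nth_of_infinite (p := (· ∈ X)) hX
  have hz : Nat.nth (· ∈ X) 0 = sInf X := by
    apply le_antisymm
    · have : sInf X ∈ Set.range (Nat.nth (· ∈ X)) := by rw [r0]; exact inf_mem hX
      obtain ⟨j, hj⟩ := this
      rw [← hj]
      exact m0.monotone (Nat.zero_le _)
    · apply Nat.sInf_le
      exact Nat.nth_mem_of_infinite (p := (· ∈ X)) hX _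
  have r2 : Set.range (fun i => Nat.nth (· ∈ X) (i + 1)) = sh X := by
    ext x
    rw [mem_sh]
    constructor
    · rintro ⟨i, rfl⟩
      refine ⟨Nat.nth_mem_of_infinite (p := (· ∈ X)) hX _, ?_⟩
      rw [← hz]
      exact (m0 (Nat.succ_pos i)).ne'
    · rintro ⟨hx, hne⟩
      rw [← r0] at hx
      obtain ⟨j, rfl⟩ := hx
      rcases j with _ | j
      · exact absurd hz hne
      · exact ⟨j, rfl⟩
  exact congrFun ((StrictMono.range_inj m1 m2).1 (r1.trans r2.symm)) i

theorem range_prefix {k m : ℕ} (h : k ≤ m) : List.range k <+: List.range m := by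
  obtain ⟨c, rfl⟩ := Nat.exists_eq_add_of_le h
  rw [List.range_add]
  exact List.prefix_append _ _

theorem tail_prefix {l m : List ℕ} (h : l <+: m) : l.tail <+: m.tail := by
  obtain ⟨t, rfl⟩ := h
  cases l with
  | nil => exact List.nil_prefix
  | cons a l => exact ⟨t, rfl⟩

/-- Locally constant arrays good implies barrier arrays good. -/
theorem bqo_barrier {β : Type*} {R : β → β → Prop} (h : Bqo R) (B : Set (List ℕ))
    (hB : IsBarrier B) (F : List ℕ → β) : ∃ s ∈ B, ∃ t ∈ B, Tri s t ∧ R (F s) (F t) := by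
  obtain ⟨hch, hinf, hblk, -⟩ := hB
  let L : Set ℕ → ℕ → List ℕ := fun X k => (List.range k).map (Nat.nth (· ∈ X))
  let K : Set ℕ → ℕ := fun X => sInf {k | L X k ∈ B}
  have hK : ∀ X, Sub (base B) X → L X (K X) ∈ B := by
    intro X hX
    have : ({k | L X k ∈ B}).Nonempty := by
      apply hblk
      · exact Nat.nth_strictMono (p := (· ∈ X)) hX.2
      · intro n
        exact hX.1 (Nat.nth_mem_of_infinite (p := (· ∈ X)) hX.2 n)
    exact Nat.sInf_mem this
  have hLC : LC (base B) (fun X => F (L X (K X))) := by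
    intro X hX
    refine ⟨Nat.nth (· ∈ X) (K X), fun Y hY hXY => ?_⟩
    have hL : ∀ k ≤ K X, L Y k = L X k := by
      intro k hk
      apply List.map_congr_left
      intro i hi
      apply nth_agree hX.2 hXY
      apply Nat.nth_strictMono (p := (· ∈ X)) hX.2
      have := List.mem_range.1 hi
      omega
    have h1 : K Y ≤ K X := by
      apply Nat.sInf_le
      change L Y (K X) ∈ B
      rw [hL _ le_rfl]; exact hK X hX
    have h2 : K X ≤ K Y := by
      apply Nat.sInf_le
      change L X (K Y) ∈ B
      rw [← hL _ h1]; exact hK Y hY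
    have h3 : K Y = K X := le_antisymm h1 h2
    simp only [h3, hL _ le_rfl]
  obtain ⟨X, hX, hR⟩ := h (base B) _ hinf hLC
  refine ⟨_, hK X hX, _, hK (sh X) (sh_sub hX), ?_, hR⟩
  refine ⟨L X (K X + K (sh X) + 1), ?_, ?_⟩
  · exact (range_prefix (by omega)).map _
  · have : L (sh X) (K (sh X)) = (L X (K (sh X) + 1)).tail := by
      simp only [L, List.range_succ_eq_map, List.map_cons, List.tail_cons, List.map_map]
      apply List.map_congr_left
      intro i _
      exact nth_sh hX.2 i
    rw [this]
    exact tail_prefix ((range_prefix (by omega)).map _)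

def stem (d : Set ℕ → ℕ) (X : Set ℕ) : Set ℕ := {x | x ∈ X ∧ x < d X}

theorem barrier_bqo {β : Type*} {R : β → β → Prop}
    (h : ∀ B : Set (List ℕ), IsBarrier B → ∀ F : List ℕ → β,
      ∃ s ∈ B, ∃ t ∈ B, Tri s t ∧ R (F s) (F t)) : Bqo R := by
  classical
  intro A f hA hf
  obtain ⟨d₀, hd₀⟩ := hf.dec
  obtain ⟨d, hd, hd2⟩ : ∃ d, WDec A f d ∧ ∀ X, Sub A X → ∃ x ∈ X, ∃ y ∈ X, x < y ∧ d X = y + 1 := by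
    refine ⟨_, hd₀.bump.bump, ?_⟩
    intro X hX
    have h1 := nx_spec hX.2 (d₀ X)
    have h2 := nx_spec hX.2 (nx X (d₀ X) + 1)
    exact ⟨_, h1.1, _, h2.1, by omega, rfl⟩
  have hlast : ∀ X, Sub A X → ∃ y ∈ stem d X, d X = y + 1 := by
    intro X hX
    obtain ⟨x, hx, y, hy, hxy, e⟩ := hd2 X hX
    exact ⟨y, ⟨hy, by omega⟩, e⟩
  have hdle : ∀ X Y, Sub A X → stem d X ⊆ stem d Y → d X ≤ d Y := by
    intro X Y hX hs
    obtain ⟨y, hy, e⟩ := hlast X hX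
    have := (hs hy).2
    omega
  have hag : ∀ X Y, Sub A X → Sub A Y → Agree (d X) X Y → stem d Y = stem d X ∧ f Y = f X := by
    intro X Y hX hY hXY
    obtain ⟨h1, h2⟩ := hd X hX Y hY hXY
    refine ⟨?_, h1⟩
    ext x
    simp only [stem, Set.mem_ofPred_eq, h2]
    constructor
    · rintro ⟨a, b⟩; exact ⟨(hXY x b).2 a, b⟩
    · rintro ⟨a, b⟩; exact ⟨(hXY x b).1 a, b⟩
  have hstemf : ∀ X Y, Sub A X → Sub A Y → stem d X = stem d Y → f X = f Y := by
    intro X Y hX hY he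
    have h1 : d X = d Y := le_antisymm (hdle X Y hX he.subset) (hdle Y X hY he.symm.subset)
    refine (hag Y X hY hX ?_).2
    intro x hx
    constructor
    · intro hxY
      have : x ∈ stem d Y := ⟨hxY, hx⟩
      rw [← he] at this
      exact this.1
    · intro hxX
      have : x ∈ stem d X := ⟨hxX, by omega⟩
      rw [he] at this
      exact this.1
  -- gluing
  have hglue : ∀ Y X, Sub A Y → Sub A X → stem d Y ⊆ stem d X →
      ∃ W, Sub X W ∧ stem d W = stem d Y := by
    intro Y X hY hX hs
    let W : Set ℕ := stem d Y ∪ {x | x ∈ X ∧ d X ≤ x}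
    have hWX : Sub X W := by
      refine ⟨?_, ?_⟩
      · rintro x (hx | hx)
        · exact (hs hx).1
        · exact hx.1
      · have := hX.2.sdiff (Set.finite_Iio (d X))
        refine this.mono ?_
        intro x hx
        exact Or.inr ⟨hx.1, by simpa using hx.2⟩
    refine ⟨W, hWX, (hag Y W hY (hWX.mono hX.1) ?_).1⟩
    intro x hx
    constructor
    · intro hxY; exact Or.inl ⟨hxY, hx⟩
    · rintro (h | h)
      · exact h.1
      · have := hdle Y X hY hs
        have := h.2
        omega
  have hfin : ∀ X, (stem d X).Finite := fun X => (Set.finite_Iio (d X)).subset (fun x hx => hx.2)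
  let c : Set ℕ → Prop := fun X => ∃ Y, Sub X Y ∧ stem d Y ⊂ stem d X
  have hc : LC A c := by
    have key : ∀ X Y, Sub A X → Sub A Y → stem d X = stem d Y → c X → c Y := by
      rintro X Y hX hY he ⟨Z, hZ, hlt⟩
      rw [he] at hlt
      obtain ⟨W, hW, e⟩ := hglue Z Y (hZ.mono hX.1) hY hlt.subset
      exact ⟨W, hW, by rwa [e]⟩
    intro X hX
    refine ⟨d X, fun Y hY hXY => propext ?_⟩
    have := (hag X Y hX hY hXY).1
    exact ⟨key Y X hY hX this, key X Y hX hY this.symm⟩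
  obtain ⟨A', hA', hh | hh⟩ := ramsey hA hc
  · exfalso
    obtain ⟨X, hX, hmin⟩ := (measure (fun X => (stem d X).ncard)).wf.has_min
      {X | Sub A' X} ⟨A', subset_rfl, hA'.2⟩
    obtain ⟨Y, hY, hlt⟩ := hh X hX
    exact hmin Y (hY.mono hX.1) (Set.ncard_lt_ncard hlt (hfin X))
  let W : List ℕ → Set ℕ → Prop := fun s X => Sub A' X ∧ ∀ x, x ∈ s ↔ x ∈ stem d X
  let B : Set (List ℕ) := {s | s.Pairwise (· < ·) ∧ ∃ X, W s X}
  have hbaseA : base B ⊆ A' := by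
    rintro x ⟨s, ⟨_, X, hX, hs⟩, hx⟩
    exact hX.1 ((hs x).1 hx).1
  have hbar : IsBarrier B := by
    refine ⟨?_, ?_, ?_, ?_⟩
    · intro s hs
      exact List.isChain_iff_pairwise.2 hs.1
    · refine hA'.2.mono ?_
      intro a ha
      let X : Set ℕ := {x | x ∈ A' ∧ a ≤ x}
      have hX : Sub A' X := by
        refine ⟨fun x hx => hx.1, ?_⟩
        refine (hA'.2.sdiff (Set.finite_Iio a)).mono ?_
        intro x hx
        exact ⟨hx.1, by simpa using hx.2⟩
      refine ⟨(hfin X).toFinset.sort (· ≤ ·), ⟨(Finset.sortedLT_sort _).pairwise, X, hX, by simp⟩, ?_⟩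
      obtain ⟨y, hy, e⟩ := hlast X (hX.mono hA'.1)
      have : a ≤ y := hy.1.2
      rw [Finset.mem_sort, Set.Finite.mem_toFinset]
      exact ⟨⟨ha, le_rfl⟩, by omega⟩
    · intro φ hφ hmem
      let X := Set.range φ
      have hX : Sub A' X := by
        refine ⟨?_, Set.infinite_range_of_injective hφ.injective⟩
        rintro _ ⟨n, rfl⟩
        exact hbaseA (hmem n)
      obtain ⟨y, ⟨⟨j, rfl⟩, _⟩, e⟩ := hlast X (hX.mono hA'.1)
      refine ⟨j+1, ?_, X, hX, ?_⟩
      · rw [List.pairwise_map]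
        exact List.Pairwise.imp (fun hab => hφ hab) List.pairwise_lt_range
      · intro x
        simp only [List.mem_map, List.mem_range, stem, Set.mem_ofPred_eq, e]
        constructor
        · rintro ⟨i, hi, rfl⟩
          refine ⟨⟨i, rfl⟩, ?_⟩
          have := hφ.monotone (show i ≤ j by omega)
          omega
        · rintro ⟨⟨i, rfl⟩, hi⟩
          refine ⟨i, ?_, rfl⟩
          have := hφ.le_iff_le.1 (show φ i ≤ φ j by omega)
          omega
    · rintro s ⟨_, X, hX, hs⟩ t ⟨_, Y, hY, ht⟩ hst n hn
      by_contra hns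
      have hsub : stem d X ⊆ stem d Y := fun x hx => (ht x).1 (hst x ((hs x).2 hx))
      obtain ⟨Z, hZ, e⟩ := hglue X Y (hX.mono hA'.1) (hY.mono hA'.1) hsub
      apply hh Y hY
      refine ⟨Z, hZ, ?_⟩
      rw [e]
      refine ⟨hsub, fun hle => hns ((hs n).2 (hle ((ht n).1 hn)))⟩
  let F : List ℕ → β := fun s => if hs : ∃ X, W s X then f hs.choose else f A'
  have hF : ∀ s X, W s X → F s = f X := by
    intro s X hX
    have hex : ∃ X, W s X := ⟨X, hX⟩
    simp only [F, dif_pos hex]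
    have hc := hex.choose_spec
    apply hstemf _ _ (hc.1.mono hA'.1) (hX.1.mono hA'.1)
    ext x
    rw [← hc.2, ← hX.2]
  obtain ⟨s, hs, t, ht, ⟨u, hsu, htu⟩, hR⟩ := h B hbar F
  -- a common increasing list
  have hBA : ∀ s ∈ B, ∀ x ∈ s, x ∈ A' := fun s hs x hx => hbaseA ⟨s, hs, hx⟩
  obtain ⟨a, b, s', rfl⟩ : ∃ a b s', s = a :: b :: s' := by
    obtain ⟨_, X, hX, hsX⟩ := hs
    obtain ⟨x, hx, y, hy, hxy, e⟩ := hd2 X (hX.mono hA'.1)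
    have h1 : x ∈ s := (hsX x).2 ⟨hx, by omega⟩
    have h2 : y ∈ s := (hsX y).2 ⟨hy, by omega⟩
    match s, h1, h2 with
    | [], h1, _ => simp at h1
    | [z], h1, h2 => simp at h1 h2; omega
    | a :: b :: s', _, _ => exact ⟨a, b, s', rfl⟩
  have hv : ∃ w : List ℕ, (a :: w).Pairwise (· < ·) ∧ (∀ x ∈ a :: w, x ∈ A') ∧
      (a :: b :: s') <+: a :: w ∧ t <+: w := by
    have hst : (b :: s') <+: u.tail := tail_prefix hsu
    rcases List.prefix_or_prefix_of_prefix hst htu with h1 | h1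
    · refine ⟨t, ?_, ?_, ?_, List.prefix_refl _⟩
      · rw [List.pairwise_cons]
        refine ⟨?_, ht.1⟩
        obtain ⟨q, rfl⟩ := h1
        have hab : a < b := (List.pairwise_cons.1 hs.1).1 b (by simp)
        intro x hx
        rw [List.cons_append, List.mem_cons] at hx
        rcases hx with rfl | hx
        · exact hab
        · have := (List.pairwise_cons.1 ht.1).1 x hx
          exact hab.trans this
      · intro x hx
        rcases List.mem_cons.1 hx with rfl | hx
        · exact hBA _ hs _ (by simp)
        · exact hBA _ ht _ hx
      · exact List.cons_prefix_cons.2 ⟨rfl, h1⟩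
    · exact ⟨b :: s', hs.1, hBA _ hs, List.prefix_refl _, h1⟩
  obtain ⟨w, hw, hwA, hsw, htw⟩ := hv
  obtain ⟨M, hM⟩ := (List.finite_toSet (a :: w)).bddAbove
  have hM : ∀ x ∈ a :: w, x ≤ M := fun x hx => hM hx
  have htail : ∀ z t : List ℕ, z.Pairwise (· < ·) → (∀ x ∈ z, x ∈ A' ∧ x ≤ M) → t <+: z → t ∈ B →
      F t = f {x | x ∈ z ∨ (x ∈ A' ∧ M < x)} ∧ Sub A' {x | x ∈ z ∨ (x ∈ A' ∧ M < x)} := by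
    intro z t hz hzA htz ht
    obtain ⟨_, X, hWX⟩ := ht
    have hsub : Sub A' {x | x ∈ z ∨ (x ∈ A' ∧ M < x)} := by
      refine ⟨?_, ?_⟩
      · rintro x (hx | hx)
        · exact (hzA x hx).1
        · exact hx.1
      · refine (hA'.2.sdiff (Set.finite_Iic M)).mono ?_
        intro x hx
        exact Or.inr ⟨hx.1, by simpa using hx.2⟩
    refine ⟨?_, hsub⟩
    rw [hF t X hWX]
    obtain ⟨hX, htX⟩ := hWX
    refine (hag X _ (hX.mono hA'.1) (hsub.mono hA'.1) ?_).2.symm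
    obtain ⟨y, hy, e⟩ := hlast X (hX.mono hA'.1)
    have hyt := (htX y).2 hy
    obtain ⟨q, rfl⟩ := htz
    rw [List.pairwise_append] at hz
    intro x hx
    constructor
    · intro hxX
      exact Or.inl (List.mem_append_left _ ((htX x).2 ⟨hxX, hx⟩))
    · rintro (hx' | hx')
      · rcases List.mem_append.1 hx' with hx' | hx'
        · exact ((htX x).1 hx').1
        · have := hz.2.2 y hyt x hx'
          omega
      · have := (hzA y (List.mem_append_left _ hyt)).2
        have := hx'.2
        omega
  obtain ⟨e1, hsub⟩ := htail (a :: w) _ hw (fun x hx => ⟨hwA x hx, hM x hx⟩) hsw hs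
  obtain ⟨e2, -⟩ := htail w t (List.pairwise_cons.1 hw).2
    (fun x hx => ⟨hwA x (List.mem_cons_of_mem _ hx), hM x (List.mem_cons_of_mem _ hx)⟩) htw ht
  refine ⟨_, hsub.mono hA'.1, ?_⟩
  rw [e1, e2] at hR
  convert hR using 2
  have haw := (List.pairwise_cons.1 hw).1
  have hinf : sInf {x | x ∈ a :: w ∨ (x ∈ A' ∧ M < x)} = a := by
    apply le_antisymm
    · exact Nat.sInf_le (Or.inl (by simp))
    · rcases inf_mem hsub.2 with h1 | h1
      · rcases List.mem_cons.1 h1 with h1 | h1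
        · exact h1.ge
        · exact (haw _ h1).le
      · exact (hM a (by simp)).trans h1.2.le
  ext x
  rw [mem_sh, hinf]
  constructor
  · rintro ⟨h1 | h1, hne⟩
    · rcases List.mem_cons.1 h1 with h1 | h1
      · exact absurd h1 hne
      · exact Or.inl h1
    · exact Or.inr h1
  · rintro (h1 | h1)
    · exact ⟨Or.inl (List.mem_cons_of_mem _ h1), (haw _ h1).ne'⟩
    · have := hM a (by simp)
      have := h1.2
      exact ⟨Or.inr h1, by omega⟩

end GHT

namespace GHT

def PathN {α : Type*} (R : α → α → Prop) : ℕ → α → α → Prop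
  | 0, x, y => x = y
  | k + 1, x, y => ∃ c, R x c ∧ PathN R k c y

theorem pathN_of_trans {α : Type*} {R : α → α → Prop} {x y : α} (h : Relation.TransGen R x y) :
    ∃ k, PathN R (k + 1) x y := by
  induction h using Relation.TransGen.head_induction_on with
  | single h => exact ⟨0, _, h, rfl⟩
  | head h _ ih =>
    obtain ⟨k, hk⟩ := ih
    exact ⟨k + 1, _, h, hk⟩

theorem flatten {α : Type*} (R : α → α → Prop) (b : ℕ → α)
    (hb : ∀ n, Relation.TransGen R (b n) (b (n + 1))) :
    ∃ c : ℕ → α, c 0 = b 0 ∧ (∀ n, R (c n) (c (n + 1))) ∧ ∀ n, ∃ m, c m = b n := by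
  let S := {p : α × ℕ × ℕ // PathN R p.2.2 p.1 (b p.2.1)}
  have hst : ∀ s : S, ∃ t : S, R s.1.1 t.1.1 ∧ (s.1.2.2 = 0 → t.1.2.1 = s.1.2.1 + 1) ∧
      (∀ k, s.1.2.2 = k + 1 → t.1.2.1 = s.1.2.1 ∧ t.1.2.2 = k) := by
    rintro ⟨⟨x, n, k⟩, h⟩
    rcases k with _ | k
    · change x = b n at h
      subst h
      obtain ⟨k, c, hc, hk⟩ := pathN_of_trans (hb n)
      exact ⟨⟨⟨c, n + 1, k⟩, hk⟩, hc, fun _ => rfl, fun k hk => by simp at hk⟩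
    · obtain ⟨c, hc, hk⟩ := h
      exact ⟨⟨⟨c, n, k⟩, hk⟩, hc, fun h => by simp at h, fun k' hk => ⟨rfl, by simpa using hk⟩⟩
  choose step h1 h2 h3 using hst
  let s : ℕ → S := fun n => Nat.rec ⟨⟨b 0, 0, 0⟩, rfl⟩ (fun _ t => step t) n
  have hs : ∀ n, s (n + 1) = step (s n) := fun n => rfl
  have key : ∀ k m, (s m).1.2.2 = k → ∃ m', (s m').1.2.1 = (s m).1.2.1 ∧ (s m').1.2.2 = 0 := by
    intro k
    induction k with
    | zero => intro m hm; exact ⟨m, rfl, hm⟩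
    | succ k ih =>
      intro m hm
      have h := h3 (s m) k hm
      rw [← hs] at h
      obtain ⟨m', e1, e2⟩ := ih (m + 1) h.2
      exact ⟨m', e1.trans h.1, e2⟩
  have main : ∀ n, ∃ m, (s m).1.2.1 = n ∧ (s m).1.2.2 = 0 := by
    intro n
    induction n with
    | zero => exact ⟨0, rfl, rfl⟩
    | succ n ih =>
      obtain ⟨m, e1, e2⟩ := ih
      have h := h2 (s m) e2
      rw [← hs] at h
      obtain ⟨m', e3, e4⟩ := key _ (m + 1) rfl
      exact ⟨m', by omega, e4⟩
  refine ⟨fun n => (s n).1.1, rfl, fun n => h1 (s n), fun n => ?_⟩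
  obtain ⟨m, e1, e2⟩ := main n
  refine ⟨m, ?_⟩
  have := (s m).2
  rw [e1, e2] at this
  exact this

theorem eventually_emb {α : Type*} {r : α → α → Prop} (hB : Bqo r) (h : ℕ → α) :
    ∃ N, ∀ n, N ≤ n → ∃ m, n < m ∧ r (h n) (h m) := by
  by_contra hcon
  push Not at hcon
  let S : Set ℕ := {n | ∀ m, n < m → ¬ r (h n) (h m)}
  have hS : S.Infinite := by
    rw [Set.infinite_iff_exists_gt]
    intro N
    obtain ⟨n, hn, hm⟩ := hcon (N + 1)
    exact ⟨n, hm, by omega⟩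
  obtain ⟨X, hX, hr⟩ := hB S (fun X => h (sInf X)) hS (by
    intro X hX
    refine ⟨sInf X + 1, fun Y hY hXY => ?_⟩
    simp only [inf_agree hX.2 hY.2 hXY (Nat.lt_succ_self _)])
  have hm := mem_sh.1 (inf_mem (sh_sub hX).2)
  have hlt : sInf X < sInf (sh X) := lt_of_le_of_ne (Nat.sInf_le hm.1) hm.2.symm
  exact hX.1 (inf_mem hX.2) _ hlt hr

section
variable {Q : Type} [Preorder Q]

noncomputable def seg (σ : TSeq Q) (a b : Ordinal) : TSeq Q := ⟨b - a, fun β => σ.f (a + β)⟩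

def Rr (σ : TSeq Q) (c d : Ordinal) : Prop := c < d ∧ InH (seg σ c d)

def Hs (Q : Type) [Preorder Q] := {σ : TSeq Q // InH σ}

def hr (a b : Hs Q) : Prop := TSeq.Emb a.1 b.1

theorem limit_step (σ : TSeq Q) (hB : Bqo (hr (Q := Q))) (b : Ordinal) (c : ℕ → Ordinal)
    (hc : ∀ n, Rr σ (c n) (c (n + 1))) (hlt : ∀ n, c n < b) (hcof : ∀ x, x < b → ∃ n, x < c n) :
    ∃ N, Rr σ (c N) b := by
  obtain ⟨N, hN⟩ := eventually_emb hB (fun n => (⟨seg σ (c n) (c (n + 1)), (hc n).2⟩ : Hs Q))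
  have hmono : StrictMono c := strictMono_nat_of_lt_succ (fun n => (hc n).1)
  have hle : ∀ n, c N ≤ c (N + n) := fun n => hmono.monotone (by omega)
  refine ⟨N, hlt N, ?_⟩
  refine InH.concat _ (fun n => seg σ (c (N + n)) (c (N + n + 1))) (fun n => (hc _).2) ?_ ?_
  · intro n
    obtain ⟨m, hm, he⟩ := hN (N + n) (by omega)
    obtain ⟨j, rfl⟩ := Nat.exists_eq_add_of_le (show N ≤ m by omega)
    exact ⟨j, by omega, he⟩
  · refine ⟨fun n => c (N + n) - c N, by simp, ?_, ?_, ?_⟩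
    · intro n
      change c (N + (n + 1)) - c N = (c (N + n) - c N) + (c (N + n + 1) - c (N + n))
      have h1 := Ordinal.add_sub_cancel_of_le (hle n)
      have h2 := Ordinal.add_sub_cancel_of_le (hle (n + 1))
      have h3 := Ordinal.add_sub_cancel_of_le (hc (N + n)).1.le
      apply add_left_cancel (a := c N)
      exact h2.trans (h3.symm.trans (by rw [← add_assoc, h1]))
    · change b - c N = _
      apply le_antisymm
      · rw [Ordinal.sub_le]
        apply le_of_forall_lt
        intro x hx
        obtain ⟨n, hn⟩ := hcof x hx
        have h4 : c n ≤ c (N + n) := hmono.monotone (by omega)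
        rw [← Ordinal.add_sub_cancel_of_le (hle n)] at h4
        refine (hn.trans_le h4).trans_le ?_
        gcongr
        exact Ordinal.le_iSup (fun n => c (N + n) - c N) n
      · apply Ordinal.iSup_le
        intro n
        rw [Ordinal.sub_le, Ordinal.add_sub_cancel_of_le (hlt N).le]
        exact (hlt _).le
    · intro n β _
      change σ.f (c N + (c (N + n) - c N + β)) = σ.f (c (N + n) + β)
      rw [← add_assoc, Ordinal.add_sub_cancel_of_le (hle n)]

theorem decomp (σ : TSeq Q) (hB : Bqo (hr (Q := Q))) (b : Ordinal) :
    b.card ≤ Cardinal.aleph0 → ∀ a, a ≤ b → Relation.ReflTransGen (Rr σ) a b := by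
  induction b using WellFoundedLT.induction with
  | ind b ih =>
  intro hb a hab
  rcases hab.eq_or_lt with rfl | hab
  · exact Relation.ReflTransGen.refl
  have hcard : ∀ x, x < b → x.card ≤ Cardinal.aleph0 :=
    fun x hx => (Ordinal.card_le_card hx.le).trans hb
  rcases Ordinal.zero_or_succ_or_isSuccLimit b with rfl | ⟨b', rfl⟩ | hlim
  · exact absurd hab (not_lt.2 zero_le)
  · have hb' : b' < Order.succ b' := Order.lt_succ b'
    refine Relation.ReflTransGen.tail (ih b' hb' (hcard _ hb') a (Order.lt_succ_iff.1 hab)) ?_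
    refine ⟨hb', InH.single _ ?_⟩
    change Order.succ b' - b' = 1
    rw [Order.succ_eq_add_one, Ordinal.add_sub_cancel]
  · have hcount : Countable (Set.Iio b) := by
      rw [← Cardinal.mk_le_aleph0_iff, Cardinal.mk_Iio_ordinal]
      exact Cardinal.lift_le_aleph0.2 hb
    have : Nonempty (Set.Iio b) := ⟨⟨a, hab⟩⟩
    obtain ⟨e, he⟩ := exists_surjective_nat (Set.Iio b)
    let nxt : ℕ → Set.Iio b → Set.Iio b := fun n x =>
      ⟨Order.succ (max x.1 (e n).1), hlim.succ_lt (max_lt x.2 (e n).2)⟩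
    let bs : ℕ → Set.Iio b := fun n => Nat.rec ⟨a, hab⟩ nxt n
    have hs : ∀ n, (bs (n + 1)).1 = Order.succ (max (bs n).1 (e n).1) := fun n => rfl
    have hlt : ∀ n, (bs n).1 < (bs (n + 1)).1 := by
      intro n
      rw [hs, Order.lt_succ_iff]
      exact le_max_left _ _
    obtain ⟨c, c0, hc, hcb⟩ := flatten (Rr σ) (fun n => (bs n).1) (by
      intro n
      rcases Relation.reflTransGen_iff_eq_or_transGen.1
        (ih _ (bs (n + 1)).2 (hcard _ (bs (n + 1)).2) _ (hlt n).le) with h | h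
      · exact absurd h (hlt n).ne'
      · exact h)
    have hmono : StrictMono c := strictMono_nat_of_lt_succ (fun n => (hc n).1)
    have hcof : ∀ x, x < b → ∃ n, x < c n := by
      intro x hx
      obtain ⟨n, hn⟩ := he ⟨x, hx⟩
      obtain ⟨m, hm⟩ := hcb (n + 1)
      refine ⟨m, ?_⟩
      rw [hm, hs, hn, Order.lt_succ_iff]
      exact le_max_right _ _
    have hbsm : StrictMono (fun n => (bs n).1) := strictMono_nat_of_lt_succ hlt
    have hcl : ∀ n, c n < b := by
      intro n
      by_contra hn
      have key : ∀ k, (bs k).1 < c n := fun k => lt_of_lt_of_le (bs k).2 (not_lt.1 hn)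
      have hmem : ∀ k, ∃ m, m < n ∧ c m = (bs k).1 := by
        intro k
        obtain ⟨m, hm⟩ := hcb k
        exact ⟨m, hmono.lt_iff_lt.1 (by rw [hm]; exact key k), hm⟩
      choose m hm1 hm2 using hmem
      have hinj : Function.Injective m := by
        intro i j hij
        apply hbsm.injective
        change (bs i).1 = (bs j).1
        rw [← hm2, ← hm2, hij]
      exact Set.infinite_range_of_injective hinj
        ((Set.finite_Iio n).subset (by rintro _ ⟨k, rfl⟩; exact hm1 k))
    obtain ⟨N, hN⟩ := limit_step σ hB b c hc hcl hcof
    have h0 : ∀ n, Relation.ReflTransGen (Rr σ) a (c n) := by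
      intro n
      induction n with
      | zero => rw [c0]; exact Relation.ReflTransGen.refl
      | succ n ihn => exact ihn.tail (hc n)
    exact (h0 N).tail hN

def Path (σ : TSeq Q) (b : Ordinal) : List (Hs Q) → Ordinal → Prop
  | [], a => a = b
  | h :: l, a => ∃ c, a ≤ c ∧ seg σ a c = h.1 ∧ Path σ b l c

theorem path_le {σ : TSeq Q} {b : Ordinal} : ∀ {l : List (Hs Q)} {a : Ordinal}, Path σ b l a → a ≤ b
  | [], _, h => le_of_eq h
  | _ :: _, _, ⟨_, hc, _, h⟩ => hc.trans (path_le h)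

theorem exists_path {σ : TSeq Q} {a b : Ordinal} (h : Relation.ReflTransGen (Rr σ) a b) :
    ∃ l, Path σ b l a := by
  induction h using Relation.ReflTransGen.head_induction_on with
  | refl => exact ⟨[], rfl⟩
  | head h _ ih =>
    obtain ⟨l, hl⟩ := ih
    exact ⟨⟨_, h.2⟩ :: l, _, h.1.le, rfl, hl⟩

def EI (σ : TSeq Q) (a b : Ordinal) (τ : TSeq Q) (a' b' : Ordinal) : Prop :=
  ∃ g : Ordinal → Ordinal, (∀ β, a ≤ β → β < b → a' ≤ g β ∧ g β < b' ∧ σ.f β ≤ τ.f (g β)) ∧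
    ∀ β γ, a ≤ β → β < γ → γ < b → g β < g γ

theorem ei_of_seg {σ τ : TSeq Q} {a c a' c' : Ordinal} (hac : a ≤ c)
    (h : TSeq.Emb (seg σ a c) (seg τ a' c')) : EI σ a c τ a' c' := by
  obtain ⟨g, h1, h2, h3⟩ := h
  have hl : ∀ β, a ≤ β → β < c → β - a < c - a := by
    intro β hβ hc
    rw [Ordinal.lt_sub, Ordinal.add_sub_cancel_of_le hβ]
    exact hc
  refine ⟨fun β => a' + g (β - a), ?_, ?_⟩
  · intro β hβ hc
    have hlt := hl β hβ hc
    refine ⟨le_self_add, Ordinal.lt_sub.1 (h1 _ hlt), ?_⟩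
    have := h3 _ hlt
    change σ.f (a + (β - a)) ≤ τ.f (a' + g (β - a)) at this
    rwa [Ordinal.add_sub_cancel_of_le hβ] at this
  · intro β γ hβ hβγ hγ
    have haγ := hβ.trans hβγ.le
    have : β - a < γ - a := by
      rw [Ordinal.lt_sub, Ordinal.add_sub_cancel_of_le hβ]
      exact hβγ
    have := h2 _ _ this (hl γ haγ hγ)
    change a' + g (β - a) < a' + g (γ - a)
    gcongr

theorem ei_glue {σ τ : TSeq Q} {a c b a' c' b' : Ordinal} (hc' : c' ≤ b') (ha' : a' ≤ c')
    (h1 : EI σ a c τ a' c') (h2 : EI σ c b τ c' b') : EI σ a b τ a' b' := by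
  classical
  obtain ⟨g, p1, p2⟩ := h1
  obtain ⟨k, q1, q2⟩ := h2
  refine ⟨fun β => if β < c then g β else k β, ?_, ?_⟩
  · intro β hβ hb
    by_cases hc : β < c
    · obtain ⟨x, y, z⟩ := p1 β hβ hc
      simp only [if_pos hc]
      exact ⟨x, y.trans_le hc', z⟩
    · obtain ⟨x, y, z⟩ := q1 β (not_lt.1 hc) hb
      simp only [if_neg hc]
      exact ⟨ha'.trans x, y, z⟩
  · intro β γ hβ hβγ hγ
    by_cases hc : β < c
    · by_cases hd : γ < c
      · simp only [if_pos hc, if_pos hd]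
        exact p2 β γ hβ hβγ hd
      · simp only [if_pos hc, if_neg hd]
        exact (p1 β hβ hc).2.1.trans_le (q1 γ (not_lt.1 hd) hγ).1
    · have hd : ¬ γ < c := fun h => hc (hβγ.trans h)
      simp only [if_neg hc, if_neg hd]
      exact q2 β γ (not_lt.1 hc) hβγ hγ

theorem ei_of_sublist {σ τ : TSeq Q} {b b' : Ordinal} {l l' : List (Hs Q)}
    (h : List.SublistForall₂ hr l l') : ∀ a a', Path σ b l a → Path τ b' l' a' →
      EI σ a b τ a' b' := by
  induction h with
  | nil =>
    intro a a' h1 _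
    change a = b at h1
    subst h1
    exact ⟨id, fun β h1 h2 => absurd h2 (not_lt.2 h1),
      fun β γ h1 h2 h3 => absurd (h2.trans h3) (not_lt.2 h1)⟩
  | cons hxy _ ih =>
    rintro a a' ⟨c, hac, e1, h1⟩ ⟨c', hac', e2, h2⟩
    refine ei_glue (path_le h2) hac' (ei_of_seg hac ?_) (ih c c' h1 h2)
    rw [e1, e2]
    exact hxy
  | cons_right _ ih =>
    rintro a a' h1 ⟨c', hac', e2, h2⟩
    obtain ⟨g, p1, p2⟩ := ih a c' h1 h2
    exact ⟨g, fun β x y => ⟨hac'.trans (p1 β x y).1, (p1 β x y).2⟩, p2⟩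

end

end GHT

/-- If the class `H` of hereditarily indecomposable `Q`-sequences is bqo under
embeddability, then `Q̃` (all countable transfinite `Q`-sequences under
embeddability) is bqo. -/
theorem stmt_16 {Q : Type} [Preorder Q]
    (hH : ∀ B : Set (List ℕ), IsBarrier B → ∀ F : List ℕ → TSeq Q,
      (∀ s ∈ B, InH (F s)) →
      ∃ s ∈ B, ∃ t ∈ B, Tri s t ∧ TSeq.Emb (F s) (F t)) :
    ∀ B : Set (List ℕ), IsBarrier B → ∀ F : List ℕ → TSeq Q,
      (∀ s : List ℕ, (F s).len.card ≤ Cardinal.aleph0) →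
      ∃ s ∈ B, ∃ t ∈ B, Tri s t ∧ TSeq.Emb (F s) (F t) := by
  have hB : GHT.Bqo (GHT.hr (Q := Q)) :=
    GHT.barrier_bqo (fun B hB F => hH B hB (fun s => (F s).1) (fun s _ => (F s).2))
  intro B hBar F hF
  have hp : ∀ s, ∃ l, GHT.Path (F s) (F s).len l 0 := fun s =>
    GHT.exists_path (GHT.decomp (F s) hB _ (hF s) 0 zero_le)
  choose l hl using hp
  obtain ⟨s, hs, t, ht, htri, hsub⟩ := GHT.bqo_barrier (GHT.ght hB) B hBar l
  obtain ⟨g, p1, p2⟩ := GHT.ei_of_sublist hsub 0 0 (hl s) (hl t)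
  exact ⟨s, hs, t, ht, htri, g, fun β h => (p1 β zero_le h).2.1,
    fun β γ h1 h2 => p2 β γ zero_le h1 h2, fun β h => (p1 β zero_le h).2.2⟩
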